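/- Let Ψ₀ be a p×q real matrix of full column rank q. Then the function Q ↦ log det(Ψ₀ᵀ Q⁻¹ Ψ₀) is convex on the convex set of symmetric positive definite p×p real matrices; that is, for all symmetric positive definite Q₁, Q₂ and all t ∈ [0,1], log det(Ψ₀ᵀ (t Q₁ + (1−t) Q₂)⁻¹ Ψ₀) ≤ t · log det(Ψ₀ᵀ Q₁⁻¹ Ψ₀) + (1−t) · log det(Ψ₀ᵀ Q₂⁻¹ Ψ₀). -/

import Mathlib

open Matrix

lemma aux_spec {n : ℕ} {A : Matrix (Fin n) (Fin n) ℝ} (hA : A.IsHermitian) :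
    ∃ (U : Matrix (Fin n) (Fin n) ℝ) (d : Fin n → ℝ), U * Uᴴ = 1 ∧ A = U * diagonal d * Uᴴ := by
  refine ⟨hA.eigenvectorUnitary, hA.eigenvalues, ?_, ?_⟩
  · exact Unitary.coe_mul_star_self hA.eigenvectorUnitary
  · have := hA.spectral_theorem
    rw [Unitary.conjStarAlgAut_apply] at this
    exact this

lemma aux_diag {n : ℕ} {A B : Matrix (Fin n) (Fin n) ℝ} (hA : A.PosDef) (hB : B.IsHermitian) :
    ∃ (P : Matrix (Fin n) (Fin n) ℝ) (d : Fin n → ℝ), IsUnit P ∧ A = Pᴴ * P ∧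
      B = Pᴴ * diagonal d * P := by
  obtain ⟨C, hC, hAC⟩ : ∃ C : Matrix (Fin n) (Fin n) ℝ, IsUnit C ∧ A = Cᴴ * C := by
    obtain ⟨U, d, hU, h⟩ := aux_spec hA.1
    have hUu : IsUnit U := IsUnit.of_mul_eq_one _ hU
    have hd : (diagonal d).PosDef := by
      have h2 := hA
      rw [h] at h2
      exact (Matrix.IsUnit.posDef_star_right_conjugate_iff hUu).1 h2
    rw [posDef_diagonal_iff] at hd
    have hAe : A = (diagonal (fun i => √(d i)) * Uᴴ)ᴴ * (diagonal (fun i => √(d i)) * Uᴴ) := by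
      rw [h, conjTranspose_mul, conjTranspose_conjTranspose, diagonal_conjTranspose]
      have : (diagonal d : Matrix (Fin n) (Fin n) ℝ)
          = diagonal (star fun i => √(d i)) * diagonal (fun i => √(d i)) := by
        rw [diagonal_mul_diagonal]
        congr 1
        funext i
        simp [Real.mul_self_sqrt (hd i).le]
      rw [this]
      simp only [Matrix.mul_assoc]
    refine ⟨_, ?_, hAe⟩
    have hu := hA.isUnit
    rw [hAe] at hu
    rw [Matrix.isUnit_iff_isUnit_det] at hu ⊢
    rw [det_mul] at hu
    exact isUnit_of_mul_isUnit_right hu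
  have hE : ((C⁻¹)ᴴ * B * C⁻¹).IsHermitian := isHermitian_conjTranspose_mul_mul _ hB
  obtain ⟨U, d, hU, h⟩ := aux_spec hE
  have hUu : IsUnit U := IsUnit.of_mul_eq_one _ hU
  have hCd := (Matrix.isUnit_iff_isUnit_det _).1 hC
  have h1 : C⁻¹ * C = 1 := Matrix.nonsing_inv_mul _ hCd
  have h2 : Cᴴ * (C⁻¹)ᴴ = 1 := by rw [← conjTranspose_mul, h1, conjTranspose_one]
  refine ⟨Uᴴ * C, d, ?_, ?_, ?_⟩
  · exact (hUu.star).mul hC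
  · rw [conjTranspose_mul, conjTranspose_conjTranspose, Matrix.mul_assoc, ← Matrix.mul_assoc U, hU,
      Matrix.one_mul, hAC]
  · calc B = (Cᴴ * (C⁻¹)ᴴ) * B * (C⁻¹ * C) := by rw [h1, h2]; simp
      _ = Cᴴ * ((C⁻¹)ᴴ * B * C⁻¹) * C := by simp only [Matrix.mul_assoc]
      _ = _ := by
        rw [h, conjTranspose_mul, conjTranspose_conjTranspose]; simp only [Matrix.mul_assoc]

lemma aux_mono {n : ℕ} {A B : Matrix (Fin n) (Fin n) ℝ} (hA : A.PosDef)
    (hB : (B - A).PosSemidef) : A.det ≤ B.det := by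
  obtain ⟨P, d, hP, h1, h2⟩ := aux_diag hA hB.1
  have hd : (diagonal d).PosSemidef := by
    rw [h2] at hB
    exact (Matrix.IsUnit.posSemidef_star_left_conjugate_iff hP).1 hB
  rw [posSemidef_diagonal_iff] at hd
  have hB' : B = Pᴴ * diagonal (fun i => 1 + d i) * P := by
    have : B = A + (B - A) := by abel
    rw [this, h2, h1]
    have : (diagonal (fun i => 1 + d i) : Matrix (Fin n) (Fin n) ℝ) = 1 + diagonal d := by
      rw [← diagonal_one, diagonal_add]
    rw [this, Matrix.mul_add, Matrix.add_mul, Matrix.mul_one]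
  have hdA : A.det = P.det * P.det := by rw [h1]; simp
  have hdB : B.det = P.det * P.det * ∏ i, (1 + d i) := by
    rw [hB']; simp; ring
  have : 1 ≤ ∏ i, (1 + d i) := by
    have h := Finset.prod_le_prod (s := Finset.univ) (f := fun _ : Fin n => (1 : ℝ))
      (g := fun i => 1 + d i) (fun i _ => zero_le_one) (fun i _ => by
        have := hd i
        linarith)
    simpa using h
  rw [hdA, hdB]
  nlinarith [mul_self_nonneg P.det]

lemma aux_concave {n : ℕ} {A B : Matrix (Fin n) (Fin n) ℝ} (hA : A.PosDef) (hB : B.PosDef)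
    (t : ℝ) (ht0 : 0 ≤ t) (ht1 : t ≤ 1) :
    t * Real.log A.det + (1 - t) * Real.log B.det ≤ Real.log (t • A + (1 - t) • B).det := by
  obtain ⟨P, d, hP, h1, h2⟩ := aux_diag hA hB.1
  have hd : (diagonal d).PosDef := by
    rw [h2] at hB
    exact (Matrix.IsUnit.posDef_star_left_conjugate_iff hP).1 hB
  rw [posDef_diagonal_iff] at hd
  have hS : t • A + (1 - t) • B = Pᴴ * diagonal (fun i => t + (1 - t) * d i) * P := by
    have : (diagonal (fun i => t + (1 - t) * d i) : Matrix (Fin n) (Fin n) ℝ)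
        = t • 1 + (1 - t) • diagonal d := by
      rw [← diagonal_one, ← diagonal_smul, ← diagonal_smul, diagonal_add]
      congr 1; funext i; simp
    rw [this, Matrix.mul_add, Matrix.add_mul, h1, h2]
    simp
  have hP0 : P.det ≠ 0 := ((Matrix.isUnit_iff_isUnit_det _).1 hP).ne_zero
  have hPP : P.det * P.det ≠ 0 := mul_ne_zero hP0 hP0
  have hpos : ∀ i, 0 < t + (1 - t) * d i := by
    intro i
    rcases ht0.eq_or_lt with h | h
    · subst h; simpa using hd i
    · have := mul_nonneg (sub_nonneg.2 ht1) (hd i).le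
      linarith
  have hdA : A.det = P.det * P.det := by rw [h1]; simp
  have hdB : B.det = P.det * P.det * ∏ i, d i := by
    rw [h2]; simp; ring
  have hdS : (t • A + (1 - t) • B).det = P.det * P.det * ∏ i, (t + (1 - t) * d i) := by
    rw [hS]; simp; ring
  rw [hdA, hdB, hdS, Real.log_mul hPP (Finset.prod_ne_zero_iff.2 fun i _ => (hd i).ne'),
    Real.log_mul hPP (Finset.prod_ne_zero_iff.2 fun i _ => (hpos i).ne'),
    Real.log_prod (fun i _ => (hd i).ne'), Real.log_prod (fun i _ => (hpos i).ne')]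
  have key : (1 - t) * ∑ i, Real.log (d i) ≤ ∑ i, Real.log (t + (1 - t) * d i) := by
    rw [Finset.mul_sum]
    apply Finset.sum_le_sum
    intro i _
    have := strictConcaveOn_log_Ioi.concaveOn.2 (Set.mem_Ioi.2 one_pos) (Set.mem_Ioi.2 (hd i))
      ht0 (sub_nonneg.2 ht1) (by ring)
    simpa using this
  linarith

lemma aux_inj {p q : ℕ} (Ψ : Matrix (Fin p) (Fin q) ℝ) (hrank : Ψ.rank = q) :
    Function.Injective Ψ.mulVec := by
  have h := LinearMap.finrank_range_add_finrank_ker Ψ.mulVecLin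
  have h' : Module.finrank ℝ (LinearMap.range Ψ.mulVecLin) = q := hrank
  rw [h', Module.finrank_fin_fun] at h
  have h0 : Module.finrank ℝ (LinearMap.ker Ψ.mulVecLin) = 0 := by omega
  have := LinearMap.ker_eq_bot.1 (Submodule.finrank_eq_zero.1 h0)
  exact this

lemma aux_schur {p q : ℕ} (Ψ : Matrix (Fin p) (Fin q) ℝ)
    {Q : Matrix (Fin p) (Fin p) ℝ} (hQ : Q.PosDef) {T : Matrix (Fin q) (Fin q) ℝ}
    (hT : T.PosDef) :
    (T - Ψᴴ * Q⁻¹ * Ψ).PosSemidef ↔ (Q - Ψ * T⁻¹ * Ψᴴ).PosSemidef := by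
  letI := hQ.isUnit.invertible
  letI := hT.isUnit.invertible
  rw [← PosDef.fromBlocks₁₁ Ψ T hQ, PosDef.fromBlocks₂₂ Q Ψ hT]

lemma aux_comb {n : ℕ} {A B : Matrix (Fin n) (Fin n) ℝ} (hA : A.PosDef) (hB : B.PosDef)
    (t : ℝ) (ht0 : 0 ≤ t) (ht1 : t ≤ 1) : (t • A + (1 - t) • B).PosDef := by
  rcases ht0.eq_or_lt with h | h
  · subst h; simpa using hB
  · exact (hA.smul h).add_posSemidef (hB.posSemidef.smul (sub_nonneg.2 ht1))

/-- Convexity of Q ↦ log det(Ψ₀ᵀ Q⁻¹ Ψ₀) on the convex set of symmetric positive definite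
matrices (Appendix C, proof of Theorem 2). -/
theorem logdet_inverse_quadform_convex {p q : ℕ}
    (Ψ₀ : Matrix (Fin p) (Fin q) ℝ) (hrank : Ψ₀.rank = q)
    (Q₁ Q₂ : Matrix (Fin p) (Fin p) ℝ) (hQ₁ : Q₁.PosDef) (hQ₂ : Q₂.PosDef)
    (t : ℝ) (ht0 : 0 ≤ t) (ht1 : t ≤ 1) :
    Real.log ((Ψ₀ᵀ * (t • Q₁ + (1 - t) • Q₂)⁻¹ * Ψ₀).det)
      ≤ t * Real.log ((Ψ₀ᵀ * Q₁⁻¹ * Ψ₀).det)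
        + (1 - t) * Real.log ((Ψ₀ᵀ * Q₂⁻¹ * Ψ₀).det) := by
  have hinj := aux_inj Ψ₀ hrank
  rw [← conjTranspose_eq_transpose_of_trivial]
  have hQ := aux_comb hQ₁ hQ₂ t ht0 ht1
  have hM₁ := hQ₁.inv.conjTranspose_mul_mul_same hinj
  have hM₂ := hQ₂.inv.conjTranspose_mul_mul_same hinj
  have hM := hQ.inv.conjTranspose_mul_mul_same hinj
  have h₁ := (aux_schur Ψ₀ hQ₁ hM₁).1 (by rw [sub_self]; exact PosSemidef.zero)
  have h₂ := (aux_schur Ψ₀ hQ₂ hM₂).1 (by rw [sub_self]; exact PosSemidef.zero)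
  generalize Ψ₀ᴴ * Q₁⁻¹ * Ψ₀ = M₁ at *
  generalize Ψ₀ᴴ * Q₂⁻¹ * Ψ₀ = M₂ at *
  have hT := aux_comb hM₁.inv hM₂.inv t ht0 ht1
  have hc := aux_concave hM₁.inv hM₂.inv t ht0 ht1
  have h := (h₁.smul ht0).add (h₂.smul (sub_nonneg.2 ht1))
  have h3 : (t • Q₁ + (1 - t) • Q₂ - Ψ₀ * ((t • M₁⁻¹ + (1 - t) • M₂⁻¹)⁻¹)⁻¹ * Ψ₀ᴴ).PosSemidef := by
    rw [Matrix.nonsing_inv_nonsing_inv _ ((Matrix.isUnit_iff_isUnit_det _).1 hT.isUnit)]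
    convert h using 1
    simp only [Matrix.mul_add, Matrix.add_mul, smul_sub, Matrix.mul_smul, Matrix.smul_mul]
    abel
  have h4 := aux_mono hM ((aux_schur Ψ₀ hQ hT.inv).2 h3)
  have h5 := Real.log_le_log hM.det_pos h4
  rw [Matrix.det_nonsing_inv, Ring.inverse_eq_inv', Real.log_inv] at h5
  simp only [Matrix.det_nonsing_inv, Ring.inverse_eq_inv', Real.log_inv] at hc
  linarith
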